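/- Let u be a forest (finite multiset) of rooted trees and let t, t' be rooted trees. Define n(u,t;t') to be the number of times t' appears in B_+(u)∘t (the coefficient of t' in the Grossman–Larson product of B_+(u) with t), and m(u,t;t') to be the number of admissible cuts c of t' such that P^c(t') = u and R^c(t') = t. Then n(u,t;t')·|Sym(t')| = m(u,t;t')·|Sym(B_+(u))|·|Sym(t)|. -/

import Mathlib

/-! ### Planar rooted trees -/

/-- A planar rooted tree: a root with an ordered list of branches.
`PTree.node [T₁,…,T_k]` is `B₊(T₁⋯T_k)`; `PTree.node []` is the one-vertex tree `•`. -/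
inductive PTree : Type where
  | node : List PTree → PTree

instance : Inhabited PTree := ⟨.node []⟩

noncomputable instance : DecidableEq PTree := Classical.decEq _

/-- Number of vertices of a planar rooted tree. -/
def PTree.size : PTree → ℕ
  | .node l => 1 + (l.attach.map (fun x => PTree.size x.1)).sum
decreasing_by
  have h := List.sizeOf_lt_of_mem x.2
  simp only [PTree.node.sizeOf_spec]
  omega

/-! ### Rooted trees -/

/-- Isomorphism of the underlying rooted trees: the lists of branches agree
up to permutation and recursive isomorphism. -/
inductive PTree.Equiv : PTree → PTree → Prop where
  | node {l m m' : List PTree} :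
      List.Forall₂ PTree.Equiv l m' → List.Perm m' m → PTree.Equiv (.node l) (.node m)

/-- Rooted trees: planar rooted trees modulo isomorphism. -/
def RTree : Type := Quot PTree.Equiv

/-- The underlying rooted tree of a planar rooted tree. -/
def toR : PTree → RTree := Quot.mk _

/-- A choice of planar representative of a rooted tree. -/
noncomputable def RTree.out : RTree → PTree := Quot.out

noncomputable instance : DecidableEq RTree := Classical.decEq _

/-- The order of the symmetry group of (the underlying rooted tree of) a planar
rooted tree: `|Sym(B₊(t₁⋯t_k))| = (∏_s m_s!)·∏ᵢ |Sym(tᵢ)|`, where `m_s` is the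
multiplicity of the isomorphism type `s` among the branches `t₁,…,t_k`. -/
noncomputable def PTree.symOrder : PTree → ℕ
  | .node l =>
      (l.attach.map (fun x => PTree.symOrder x.1)).prod *
      (((l.map toR : List RTree) : Multiset RTree).toFinset.prod
        (fun s => (Multiset.count s (l.map toR : Multiset RTree)).factorial))
decreasing_by
  have h := List.sizeOf_lt_of_mem x.2
  simp only [PTree.node.sizeOf_spec]
  omega

/-- The order of the symmetry group of a rooted tree. -/
noncomputable def RTree.sym (t : RTree) : ℕ := t.out.symOrder

/-- Number of vertices of a rooted tree. -/
noncomputable def RTree.size (t : RTree) : ℕ := t.out.size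

/-- `B₊` for rooted trees: attach a new root to a multiset forest. -/
noncomputable def RTree.node (m : Multiset RTree) : RTree :=
  toR (PTree.node (m.toList.map RTree.out))

/-- The one-vertex rooted tree `•`. -/
noncomputable def RTree.bullet : RTree := toR (.node [])

/-! ### The Grossman–Larson product -/

namespace PTree

mutual
/-- The list of vertices of a planar rooted tree, as paths from the root. -/
def positions : PTree → List (List ℕ)
  | .node l => [] :: positionsList 0 l
/-- Vertices of the trees in a forest, as paths (first coordinate = index in forest). -/
def positionsList : ℕ → List PTree → List (List ℕ)
  | _, [] => []
  | i, t :: ts => (positions t).map (i :: ·) ++ positionsList (i+1) ts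
end

/-- Attach the tree `s` by a new edge to the vertex of a tree at the given path
(as a new last child). -/
def attachAt (s : PTree) : PTree → List ℕ → PTree
  | .node l, [] => .node (l ++ [s])
  | .node l, i :: p => .node (l.set i (attachAt s l[i]! p))

/-- Attach several trees at given vertices, in order. -/
def attachMany : PTree → List (List ℕ × PTree) → PTree
  | t, [] => t
  | t, (p, s) :: rest => attachMany (attachAt s t p) rest

end PTree

/-- Grossman–Larson product of planar representatives, with values in the free
`k`-module on rooted trees: for `t = B₊(t₁⋯t_n)` and a tree `t'` with `m`
vertices, the sum of the `m^n` rooted trees obtained by attaching each `tᵢ`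
to a vertex of `t'`. -/
noncomputable def glMulP (k : Type*) [Semiring k] (t t' : PTree) : RTree →₀ k :=
  match t with
  | .node l =>
    (((List.replicate l.length (PTree.positions t')).sections).map
      (fun ps => Finsupp.single (toR (PTree.attachMany t' (ps.zip l))) (1 : k))).sum

/-- Grossman–Larson product of rooted trees. -/
noncomputable def glMul (k : Type*) [Semiring k] (a b : RTree) : RTree →₀ k :=
  glMulP k a.out b.out

/-- Bilinear extension of the Grossman–Larson product to the free module `kT`. -/
noncomputable def glMulF {k : Type*} [CommSemiring k] (f g : RTree →₀ k) : RTree →₀ k :=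
  f.sum (fun a x => g.sum (fun b y => (x * y) • glMul k a b))

/-! ### Cuts -/

/-- A decoration of (the edges of) a tree by Booleans: `true` means the edge
belongs to the cut. `Cut.node [(b₁,c₁),…,(b_k,c_k)]` matches a tree
`PTree.node [t₁,…,t_k]`, with `bᵢ` decorating the edge from the root to `tᵢ`
and `cᵢ` a cut of `tᵢ`. -/
inductive Cut : Type where
  | node : List (Bool × Cut) → Cut

namespace Cut

mutual
/-- The number of edges in a cut. -/
def size : Cut → ℕ
  | .node l => sizeList l
/-- The number of edges in a list of decorated edges. -/
def sizeList : List (Bool × Cut) → ℕ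
  | [] => 0
  | (b, c) :: cs => (if b then 1 else 0) + size c + sizeList cs
end

mutual
/-- The cut containing no edges. -/
def isEmpty : Cut → Bool
  | .node l => isEmptyList l
/-- Whether a list of decorated edges contains no cut edge. -/
def isEmptyList : List (Bool × Cut) → Bool
  | [] => true
  | (b, c) :: cs => !b && isEmpty c && isEmptyList cs
end

mutual
/-- A cut is admissible if every path from the root to a leaf meets it at most
once, i.e. below a cut edge there is no further cut edge. -/
def admissible : Cut → Bool
  | .node l => admissibleList l
/-- Admissibility for a list of decorated edges. -/
def admissibleList : List (Bool × Cut) → Bool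
  | [] => true
  | (b, c) :: cs => (if b then isEmpty c else admissible c) && admissibleList cs
end

end Cut

namespace PTree

mutual
/-- All cuts (edge subsets) of a planar rooted tree. -/
def cutsOf : PTree → List Cut
  | .node l => (cutsOfList l).map Cut.node
/-- All decorations of a forest. -/
def cutsOfList : List PTree → List (List (Bool × Cut))
  | [] => [[]]
  | t :: ts =>
      (cutsOf t).flatMap (fun c =>
        (cutsOfList ts).flatMap (fun cs => [(true, c) :: cs, (false, c) :: cs]))
end

mutual
/-- `cutPieces t c = (R^c(t), P^c(t))`: the root component of `t` after removing
the edges of `c`, together with the ordered forest of the remaining components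
(in planar depth-first order). -/
def cutPieces : PTree → Cut → PTree × List PTree
  | .node l, .node cs =>
      ((PTree.node (cutPiecesList l cs).1 : PTree), (cutPiecesList l cs).2)
/-- `cutPieces` for forests. -/
def cutPiecesList : List PTree → List (Bool × Cut) → List PTree × List PTree
  | [], _ => ([], [])
  | _ :: _, [] => ([], [])
  | t :: ts, (b, c) :: cs =>
      let p := cutPieces t c
      let q := cutPiecesList ts cs
      if b then (q.1, (p.1 :: p.2) ++ q.2) else (p.1 :: q.1, p.2 ++ q.2)
end

/-- `R^c(T)`, the component containing the root. -/
def Rcut (t : PTree) (c : Cut) : PTree := (cutPieces t c).1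

/-- `P^c(T)`, the ordered forest of components not containing the root. -/
def Pcut (t : PTree) (c : Cut) : List PTree := (cutPieces t c).2

end PTree

/-- `R^c` for rooted trees. -/
noncomputable def RcutR (t : RTree) (c : Cut) : RTree := toR (t.out.Rcut c)

/-- `P^c` for rooted trees: a multiset forest. -/
noncomputable def PcutR (t : RTree) (c : Cut) : Multiset RTree :=
  ((t.out.Pcut c).map toR : List RTree)


namespace PTree

/-! ### Rooted trees as multisets of branches -/

/-- The list of branches of a planar rooted tree. -/
def branches : PTree → List PTree
  | .node l => l

@[simp] theorem branches_node (l : List PTree) : (node l).branches = l := rfl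

@[simp] theorem node_branches (t : PTree) : node t.branches = t := by cases t; rfl

/-- The multiset of isomorphism classes of a list of planar rooted trees. -/
def forest (l : List PTree) : Multiset RTree := (l.map toR : List RTree)

@[simp] theorem forest_nil : forest [] = 0 := rfl

@[simp] theorem forest_cons (t : PTree) (l : List PTree) :
    forest (t :: l) = toR t ::ₘ forest l := rfl

@[simp] theorem forest_append (l m : List PTree) : forest (l ++ m) = forest l + forest m := by
  simp [forest]

theorem toR_out (t : RTree) : toR t.out = t := Quot.out_eq t

theorem equiv_refl : ∀ t : PTree, Equiv t t
  | .node l => .node (List.forall₂_same.2 fun x _ => equiv_refl x) (List.Perm.refl l)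
decreasing_by
  rename_i h
  have := List.sizeOf_lt_of_mem h
  simp only [PTree.node.sizeOf_spec]
  omega

theorem toR_node_of_perm {l m : List PTree} (h : l.Perm m) : toR (node l) = toR (node m) :=
  Quot.sound (.node (List.forall₂_same.2 fun x _ => equiv_refl x) h)

theorem toR_node_cons_congr {s t : PTree} (l : List PTree) (h : toR s = toR t) :
    toR (node (s :: l)) = toR (node (t :: l)) := by
  have h' := Quot.eqvGen_exact h
  clear h
  induction h' with
  | rel x y hxy =>
    exact Quot.sound (.node (.cons hxy (List.forall₂_same.2 fun x _ => equiv_refl x))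
      (List.Perm.refl _))
  | refl => rfl
  | symm x y _ ih => exact ih.symm
  | trans x y z _ _ ih₁ ih₂ => exact ih₁.trans ih₂

theorem toR_node_map_out (l m : List PTree) :
    toR (node (l ++ m)) = toR (node ((l.map toR).map RTree.out ++ m)) := by
  induction l generalizing m with
  | nil => rfl
  | cons t l ih =>
    calc toR (node (t :: l ++ m)) = toR (node (l ++ t :: m)) :=
          toR_node_of_perm List.perm_middle.symm
      _ = toR (node ((l.map toR).map RTree.out ++ t :: m)) := ih _
      _ = toR (node (t :: ((l.map toR).map RTree.out ++ m))) := toR_node_of_perm List.perm_middle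
      _ = _ := toR_node_cons_congr _ (toR_out _).symm

theorem forest_branches_of_equiv {s t : PTree} (h : Equiv s t) :
    forest s.branches = forest t.branches := by
  obtain @⟨l, m, m', h₁, h₂⟩ := h
  have : l.map toR = m'.map toR := by
    clear h₂
    induction h₁ with
    | nil => rfl
    | cons h _ ih => rw [List.map_cons, List.map_cons, ih, show toR _ = toR _ from Quot.sound h]
  simp only [forest, branches_node, this]
  exact Multiset.coe_eq_coe.2 (h₂.map _)

theorem forest_branches_congr {s t : PTree} (h : toR s = toR t) :
    forest s.branches = forest t.branches :=
  congrArg (Quot.lift (fun r : PTree => forest r.branches) fun _ _ => forest_branches_of_equiv :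
    RTree → Multiset RTree) h

theorem toR_node_eq_iff {l m : List PTree} :
    toR (node l) = toR (node m) ↔ forest l = forest m := by
  refine ⟨fun h => forest_branches_congr h, fun h => ?_⟩
  have hl := toR_node_map_out l []
  have hm := toR_node_map_out m []
  simp only [List.append_nil] at hl hm
  rw [hl, hm]
  exact toR_node_of_perm ((Multiset.coe_eq_coe.1 h).map _)

theorem toR_eq_iff {s t : PTree} : toR s = toR t ↔ forest s.branches = forest t.branches := by
  rw [← toR_node_eq_iff, node_branches, node_branches]

/-! ### Orders of symmetry groups -/

theorem symOrder_eq_of_equiv : ∀ (s t : PTree), Equiv s t → s.symOrder = t.symOrder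
  | .node l, .node m, h => by
    have hf : forest l = forest m := forest_branches_of_equiv h
    obtain @⟨_, _, m', h₁, h₂⟩ := h
    have h₃ : l.map symOrder = m'.map symOrder := by
      have key : ∀ x ∈ l, ∀ y, Equiv x y → x.symOrder = y.symOrder :=
        fun x hx y hxy => symOrder_eq_of_equiv x y hxy
      clear h₂ hf
      induction h₁ with
      | nil => rfl
      | cons h _ ih =>
        rw [List.map_cons, List.map_cons, ih fun x hx => key x (List.mem_cons_of_mem _ hx),
          key _ List.mem_cons_self _ h]
    rw [symOrder, symOrder]
    simp only [forest] at hf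
    rw [hf]
    simp only [List.attach_map_val (f := symOrder)]
    rw [h₃, (h₂.map symOrder).prod_eq]
termination_by s => sizeOf s
decreasing_by
  have := List.sizeOf_lt_of_mem hx
  simp only [PTree.node.sizeOf_spec]
  omega

theorem sym_toR (t : PTree) : (toR t).sym = t.symOrder :=
  congrArg (Quot.lift symOrder symOrder_eq_of_equiv) (toR_out (toR t))

/-- The order of the symmetry group of a multiset forest. -/
noncomputable def forestSym (m : Multiset RTree) : ℚ :=
  (m.map fun s => (s.sym : ℚ)).prod * ∏ s ∈ m.toFinset, ((m.count s).factorial : ℚ)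

theorem sym_toR_node (l : List PTree) : ((toR (node l)).sym : ℚ) = forestSym (forest l) := by
  rw [sym_toR, symOrder, forestSym]
  simp only [List.attach_map_val (f := symOrder), forest]
  push_cast
  simp only [Multiset.map_coe, Multiset.prod_coe, List.map_map]
  rw [List.map_congr_left (g := (fun s : RTree => (s.sym : ℚ)) ∘ toR) fun x _ => by
    simp [sym_toR]]

theorem forestSym_cons (a : RTree) (m : Multiset RTree) :
    forestSym (a ::ₘ m) = (m.count a + 1) * a.sym * forestSym m := by
  have key (n : Multiset RTree) (h : n ≤ a ::ₘ m) :
      ∏ s ∈ n.toFinset, ((n.count s).factorial : ℚ)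
        = ∏ s ∈ insert a m.toFinset, ((n.count s).factorial : ℚ) := by
    refine Finset.prod_subset (fun x hx => ?_) fun x _ hx => ?_
    · simpa using Multiset.mem_of_le h (Multiset.mem_toFinset.1 hx)
    · simp [Multiset.count_eq_zero_of_notMem (mt Multiset.mem_toFinset.2 hx)]
  rw [forestSym, forestSym, key _ le_rfl, key m (Multiset.le_cons_self m a),
    ← Finset.mul_prod_erase _ _ (Finset.mem_insert_self a _),
    ← Finset.mul_prod_erase (insert a m.toFinset) (fun s => ((m.count s).factorial : ℚ))
      (Finset.mem_insert_self a _),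
    Finset.prod_congr rfl (g := fun s => ((m.count s).factorial : ℚ))
      fun x hx => by rw [Multiset.count_cons_of_ne (Finset.ne_of_mem_erase hx)]]
  rw [Multiset.count_cons_self, Nat.factorial_succ]
  simp only [Multiset.map_cons, Multiset.prod_cons]
  push_cast
  ring

/-! ### The symmetry pairing on forests -/

/-- The number of isomorphisms between two multiset forests. -/
noncomputable def pairing (u v : Multiset RTree) : ℚ := if u = v then forestSym u else 0

theorem pairing_cons (a : RTree) (u v : Multiset RTree) :
    pairing (a ::ₘ u) v = v.count a * a.sym * pairing u (v.erase a) := by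
  by_cases ha : a ∈ v
  · obtain ⟨w, rfl⟩ := Multiset.exists_cons_of_mem ha
    simp only [pairing, Multiset.cons_inj_right, Multiset.erase_cons_head]
    split_ifs with h
    · rw [forestSym_cons, Multiset.count_cons_self, h]; push_cast; rfl
    · simp
  · rw [Multiset.count_eq_zero_of_notMem ha, pairing,
      if_neg fun h : a ::ₘ u = v => ha (h ▸ Multiset.mem_cons_self a u)]
    simp

/-- All ways to distribute the entries of a list over two lists. -/
def splits : List PTree → List (List PTree × List PTree)
  | [] => [([], [])]
  | s :: u => (splits u).map (fun x => (s :: x.1, x.2)) ++ (splits u).map fun x => (x.1, s :: x.2)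

/-- All ways to single out one entry of a list. -/
def picks : List PTree → List (PTree × List PTree)
  | [] => []
  | b :: g => (b, g) :: (picks g).map fun x => (x.1, b :: x.2)

theorem pairing_add (u : List PTree) (v w : Multiset RTree) :
    pairing (forest u) (v + w)
      = ((splits u).map fun x => pairing (forest x.1) v * pairing (forest x.2) w).sum := by
  induction u generalizing v w with
  | nil =>
    simp only [splits, pairing, forest_nil, List.map_cons, List.map_nil, List.sum_singleton]
    by_cases hv : 0 = v
    · subst hv; simp [forestSym]
    · have : ¬ (0 = v + w) := fun h => hv (by simpa using (add_eq_zero.1 h.symm).1.symm)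
      simp [hv, this]
  | cons s u ih =>
    have h₁ : ((v + w).count (toR s) : ℚ) * (toR s).sym * pairing (forest u) ((v + w).erase (toR s))
        = v.count (toR s) * (toR s).sym * pairing (forest u) (v.erase (toR s) + w)
          + w.count (toR s) * (toR s).sym * pairing (forest u) (v + w.erase (toR s)) := by
      rw [Multiset.count_add]
      have hv : (v.count (toR s) : ℚ) * pairing (forest u) ((v + w).erase (toR s))
          = v.count (toR s) * pairing (forest u) (v.erase (toR s) + w) := by
        by_cases h : toR s ∈ v
        · rw [Multiset.erase_add_left_pos _ h]
        · simp [Multiset.count_eq_zero_of_notMem h]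
      have hw : (w.count (toR s) : ℚ) * pairing (forest u) ((v + w).erase (toR s))
          = w.count (toR s) * pairing (forest u) (v + w.erase (toR s)) := by
        by_cases h : toR s ∈ w
        · rw [Multiset.erase_add_right_pos _ h]
        · simp [Multiset.count_eq_zero_of_notMem h]
      push_cast
      linear_combination ((toR s).sym : ℚ) * (hv + hw)
    rw [forest_cons, pairing_cons, h₁, ih, ih]
    simp only [splits, List.map_append, List.map_map, List.sum_append, Function.comp_def,
      forest_cons, pairing_cons, ← List.sum_map_mul_left]
    congr 3 <;> funext x <;> ring

theorem sum_picks (a : RTree) (g : List PTree) (H : Multiset RTree → ℚ) :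
    ((picks g).map fun x => if a = toR x.1 then H (forest x.2) else 0).sum
      = (forest g).count a * H ((forest g).erase a) := by
  induction g generalizing H with
  | nil => simp [picks]
  | cons b g ih =>
    simp only [picks, List.map_cons, List.map_map, Function.comp_def, List.sum_cons, forest_cons]
    rw [ih fun m => H (toR b ::ₘ m)]
    by_cases h : a = toR b
    · subst h
      simp only [if_true, Multiset.count_cons_self, Multiset.erase_cons_head]
      by_cases h' : toR b ∈ forest g
      · rw [Multiset.cons_erase h']; push_cast; ring
      · simp [Multiset.count_eq_zero_of_notMem h']
    · rw [if_neg h, Multiset.count_cons_of_ne h, Multiset.erase_cons_tail _ (Ne.symm h), zero_add]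

theorem pairing_branches (s t : PTree) :
    pairing (forest s.branches) (forest t.branches)
      = if toR s = toR t then ((toR s).sym : ℚ) else 0 := by
  simp only [pairing, toR_eq_iff, ← sym_toR_node, node_branches]

theorem pairing_cons_forest (t : PTree) (u : Multiset RTree) (g : List PTree) :
    pairing (toR t ::ₘ u) (forest g)
      = ((picks g).map fun x => pairing (forest t.branches) (forest x.1.branches)
          * pairing u (forest x.2)).sum := by
  have h := sum_picks (toR t) g fun m => (toR t).sym * pairing u m
  rw [pairing_cons, mul_assoc, ← h]
  refine congrArg List.sum (List.map_congr_left fun x _ => ?_)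
  rw [pairing_branches, ite_mul, zero_mul]

/-! ### Sums over lists -/

theorem sum_map_flatMap {α β : Type*} (l : List α) (f : α → List β) (F : β → ℚ) :
    ((l.flatMap f).map F).sum = (l.map fun x => ((f x).map F).sum).sum := by
  induction l with
  | nil => rfl
  | cons a l ih => simp [ih]

theorem sum_map_comm {α β : Type*} (l : List α) (m : List β) (F : α → β → ℚ) :
    (l.map fun x => (m.map fun y => F x y).sum).sum
      = (m.map fun y => (l.map fun x => F x y).sum).sum := by
  induction l with
  | nil => simp
  | cons a l ih => simp [ih, List.sum_map_add]

/-! ### Iterated attachments -/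

/-- All trees obtained from `t` by attaching the entries of `u` at positions from `L`. -/
def attachments (L : List (List ℕ)) : List PTree → PTree → List PTree
  | [], t => [t]
  | s :: u, t => L.flatMap fun p => attachments L u (attachAt s t p)

theorem attachments_perm {L M : List (List ℕ)} (h : L.Perm M) (u : List PTree) (t : PTree) :
    (attachments L u t).Perm (attachments M u t) := by
  induction u generalizing t with
  | nil => rfl
  | cons s u ih => exact h.flatMap fun p _ => ih _

theorem sum_sections (L : List (List ℕ)) (u : List PTree) (t : PTree) (F : PTree → ℚ) :
    (((List.replicate u.length L).sections).map fun ps => F (attachMany t (ps.zip u))).sum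
      = ((attachments L u t).map F).sum := by
  induction u generalizing t with
  | nil => simp [attachments, attachMany]
  | cons s u ih =>
    simp only [List.length_cons, List.replicate_succ, List.sections, attachments,
      sum_map_flatMap, List.map_map, Function.comp_def, List.zip_cons_cons, attachMany]
    rw [sum_map_comm]
    simp only [ih]

/-- Increase the first entry of a path. -/
def shift : List ℕ → List ℕ
  | [] => []
  | i :: p => (i + 1) :: p

theorem positionsList_succ (i : ℕ) (l : List PTree) :
    positionsList (i + 1) l = (positionsList i l).map shift := by
  induction l generalizing i with
  | nil => simp [positionsList]
  | cons t l ih => simp [positionsList, ih (i + 1), shift, Function.comp_def]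

theorem positions_node_cons (a : PTree) (f : List PTree) :
    (positions (node (a :: f))).Perm
      ((positions a).map (0 :: ·) ++ (positions (node f)).map shift) := by
  simp only [positions, positionsList, positionsList_succ 0, List.map_cons, shift]
  exact List.perm_middle.symm

theorem attachAt_shift (s a : PTree) (f : List PTree) (p : List ℕ) :
    attachAt s (node (a :: f)) (shift p) = node (a :: (attachAt s (node f) p).branches) := by
  cases p <;> simp [shift, attachAt]

theorem sum_attachments_cons (L M : List (List ℕ)) (u : List PTree) (a : PTree) (f : List PTree)
    (F : PTree → ℚ) :
    ((attachments (L.map (0 :: ·) ++ M.map shift) u (node (a :: f))).map F).sum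
      = ((splits u).map fun x => ((attachments L x.1 a).map fun b =>
          ((attachments M x.2 (node f)).map fun d => F (node (b :: d.branches))).sum).sum).sum := by
  induction u generalizing a f with
  | nil => simp [attachments, splits]
  | cons s u ih =>
    have h₀ (p : List ℕ) :
        attachAt s (node (a :: f)) (0 :: p) = node (attachAt s a p :: f) := by
      simp [attachAt]
    simp only [attachments, sum_map_flatMap, splits, List.map_append, List.sum_append,
      List.map_map, Function.comp_def, h₀, attachAt_shift, ih, node_branches]
    congr 1
    · rw [sum_map_comm]
    · rw [sum_map_comm]
      refine congrArg List.sum (List.map_congr_left fun x _ => ?_)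
      rw [sum_map_comm]

theorem sum_attachments_nil (u l : List PTree) (F : PTree → ℚ) :
    ((attachments (positions (node [])) u (node l)).map F).sum = F (node (l ++ u)) := by
  induction u generalizing l with
  | nil => simp [attachments]
  | cons s u ih =>
    simp only [positions, positionsList] at ih
    simp [attachments, positions, positionsList, attachAt, ih]

/-! ### Admissible cuts -/

/-- The pairs `(R^c, P^c)` for the admissible cuts `c` of a forest. -/
noncomputable def cutPairs (g : List PTree) : List (List PTree × Multiset RTree) :=
  ((cutsOfList g).filter fun cs => Cut.admissibleList cs).map fun cs =>
    ((cutPiecesList g cs).1, forest (cutPiecesList g cs).2)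

theorem isEmptyList_cons_true (c : Cut) (cs : List (Bool × Cut)) :
    Cut.isEmptyList ((true, c) :: cs) = false := by
  simp [Cut.isEmptyList]

theorem isEmptyList_cons_false (c cs : List (Bool × Cut)) :
    Cut.isEmptyList ((false, .node c) :: cs) = (Cut.isEmptyList c && Cut.isEmptyList cs) := by
  simp [Cut.isEmptyList, Cut.isEmpty]

theorem admissibleList_cons_true (c cs : List (Bool × Cut)) :
    Cut.admissibleList ((true, .node c) :: cs)
      = (Cut.isEmptyList c && Cut.admissibleList cs) := by
  simp [Cut.admissibleList, Cut.isEmpty]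

theorem admissibleList_cons_false (c cs : List (Bool × Cut)) :
    Cut.admissibleList ((false, .node c) :: cs)
      = (Cut.admissibleList c && Cut.admissibleList cs) := by
  simp [Cut.admissibleList, Cut.admissible]

theorem cutPiecesList_cons_true (h g : List PTree) (c cs : List (Bool × Cut)) :
    cutPiecesList (node h :: g) ((true, .node c) :: cs)
      = ((cutPiecesList g cs).1,
        node (cutPiecesList h c).1 :: ((cutPiecesList h c).2 ++ (cutPiecesList g cs).2)) := by
  simp [cutPiecesList, cutPieces]

theorem cutPiecesList_cons_false (h g : List PTree) (c cs : List (Bool × Cut)) :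
    cutPiecesList (node h :: g) ((false, .node c) :: cs)
      = (node (cutPiecesList h c).1 :: (cutPiecesList g cs).1,
        (cutPiecesList h c).2 ++ (cutPiecesList g cs).2) := by
  simp [cutPiecesList, cutPieces]

theorem sum_cutsOfList_cons (h g : List PTree) (F : List (Bool × Cut) → ℚ) :
    ((cutsOfList (node h :: g)).map F).sum = ((cutsOfList h).map fun c =>
      ((cutsOfList g).map fun cs =>
        F ((true, .node c) :: cs) + F ((false, .node c) :: cs)).sum).sum := by
  rw [cutsOfList, cutsOf]
  simp [sum_map_flatMap, List.flatMap_map]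

theorem sum_map_filter {α : Type*} (l : List α) (p : α → Bool) (F : α → ℚ) :
    ((l.filter p).map F).sum = (l.map fun x => bif p x then F x else 0).sum := by
  induction l with
  | nil => rfl
  | cons a l ih => by_cases h : p a <;> simp [h, ih]

theorem sum_cutsOfList_isEmpty : ∀ (g : List PTree) (F : List PTree × List PTree → ℚ),
    ((cutsOfList g).map fun cs => bif Cut.isEmptyList cs then F (cutPiecesList g cs) else 0).sum
      = F (g, [])
  | [], F => by simp [cutsOfList, Cut.isEmptyList, cutPiecesList]
  | .node h :: g, F => by
    have e (c cs : List (Bool × Cut)) :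
        (bif (Cut.isEmptyList c && Cut.isEmptyList cs)
          then F (node (cutPiecesList h c).1 :: (cutPiecesList g cs).1,
            (cutPiecesList h c).2 ++ (cutPiecesList g cs).2) else 0)
        = bif Cut.isEmptyList c then (bif Cut.isEmptyList cs
          then F (node (cutPiecesList h c).1 :: (cutPiecesList g cs).1,
            (cutPiecesList h c).2 ++ (cutPiecesList g cs).2) else 0) else 0 := by
      cases Cut.isEmptyList c <;> rfl
    simp only [sum_cutsOfList_cons, isEmptyList_cons_true, isEmptyList_cons_false,
      cutPiecesList_cons_false, cond_false, zero_add, e]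
    rw [sum_map_comm]
    have e₃ := fun cs : List (Bool × Cut) => sum_cutsOfList_isEmpty h fun x =>
      bif Cut.isEmptyList cs then
        F (node x.1 :: (cutPiecesList g cs).1, x.2 ++ (cutPiecesList g cs).2) else 0
    simp only [e₃]
    exact sum_cutsOfList_isEmpty g fun y => F (node h :: y.1, [] ++ y.2)

theorem sum_cutPairs (g : List PTree) (F : List PTree × Multiset RTree → ℚ) :
    ((cutPairs g).map F).sum = ((cutsOfList g).map fun cs => bif Cut.admissibleList cs then
      F ((cutPiecesList g cs).1, forest (cutPiecesList g cs).2) else 0).sum := by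
  rw [cutPairs, List.map_map, sum_map_filter]
  rfl

theorem sum_cutPairs_nil (F : List PTree × Multiset RTree → ℚ) :
    ((cutPairs []).map F).sum = F ([], 0) := by
  simp [sum_cutPairs, cutsOfList, Cut.admissibleList, cutPiecesList]

theorem sum_cutPairs_cons (h g : List PTree) (F : List PTree × Multiset RTree → ℚ) :
    ((cutPairs (node h :: g)).map F).sum
      = ((cutPairs g).map fun y => F (y.1, toR (node h) ::ₘ y.2)).sum
        + ((cutPairs h).map fun x => ((cutPairs g).map fun y =>
            F (node x.1 :: y.1, x.2 + y.2)).sum).sum := by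
  have e (a b : Bool) (r : ℚ) :
      (bif (a && b) then r else 0) = bif a then (bif b then r else 0) else 0 := by
    cases a <;> simp
  have e' (a : Bool) {α : Type} (l : List α) (G : α → ℚ) :
      (l.map fun y => bif a then G y else 0).sum
        = bif a then (l.map G).sum else 0 := by
    cases a <;> simp
  simp only [sum_cutPairs, sum_cutsOfList_cons, admissibleList_cons_true,
    admissibleList_cons_false, cutPiecesList_cons_true, cutPiecesList_cons_false, e,
    List.sum_map_add, e', forest_append, forest_cons]
  congr 1
  rw [sum_cutsOfList_isEmpty h fun x => ((cutsOfList g).map fun cs =>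
    bif Cut.admissibleList cs then F ((cutPiecesList g cs).1,
      toR (node x.1) ::ₘ (forest x.2 + forest (cutPiecesList g cs).2)) else 0).sum]
  simp

theorem sum_cutPairs_pairing_zero (g : List PTree) (H : Multiset RTree → ℚ) :
    ((cutPairs g).map fun y => H y.2 * pairing 0 (forest y.1)).sum = H (forest g) := by
  induction g generalizing H with
  | nil => simp [sum_cutPairs_nil, pairing, forestSym]
  | cons b g ih =>
    obtain ⟨h⟩ := b
    have e (a : RTree) (m : Multiset RTree) : pairing 0 (a ::ₘ m) = 0 :=
      if_neg (Multiset.zero_ne_cons)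
    rw [sum_cutPairs_cons, ih fun m => H (toR (node h) ::ₘ m)]
    simp [e]

theorem sum_cutPairs_picks (g : List PTree) (K : PTree → List PTree → Multiset RTree → ℚ) :
    ((cutPairs g).map fun y => ((picks y.1).map fun z => K z.1 z.2 y.2).sum).sum
      = ((picks g).map fun z => ((cutPairs z.1.branches).map fun x => ((cutPairs z.2).map fun y =>
          K (node x.1) y.1 (x.2 + y.2)).sum).sum).sum := by
  induction g generalizing K with
  | nil => simp [sum_cutPairs_nil, picks]
  | cons b g ih =>
    obtain ⟨h⟩ := b
    rw [sum_cutPairs_cons, ih fun b r q => K b r (toR (node h) ::ₘ q)]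
    simp only [picks, List.map_cons, List.sum_cons, List.map_map, Function.comp_def,
      sum_cutPairs_cons, List.sum_map_add, branches_node, Multiset.add_cons]
    have e (x : List PTree × Multiset RTree) :=
      ih fun b r q => K b (node x.1 :: r) (x.2 + q)
    simp only [e]
    have e' (z : PTree × List PTree) :
        ((cutPairs h).map fun x => ((cutPairs z.1.branches).map fun x' =>
          ((cutPairs z.2).map fun y =>
            K (node x'.1) (node x.1 :: y.1) (x.2 + (x'.2 + y.2))).sum).sum).sum
        = ((cutPairs z.1.branches).map fun x' => ((cutPairs h).map fun x =>
          ((cutPairs z.2).map fun y =>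
            K (node x'.1) (node x.1 :: y.1) (x'.2 + (x.2 + y.2))).sum).sum).sum := by
      rw [sum_map_comm]
      refine congrArg List.sum (List.map_congr_left fun x _ => congrArg List.sum
        (List.map_congr_left fun x' _ => congrArg List.sum (List.map_congr_left fun y _ => ?_)))
      rw [add_left_comm]
    rw [sum_map_comm (cutPairs h) (picks g)]
    simp only [e']
    ring

/-- Grafting is adjoint to cutting with respect to the symmetry pairing. -/
theorem sum_attachments_pairing : ∀ (f u g : List PTree),
    ((attachments (positions (node f)) u (node f)).map fun d =>
        pairing (forest d.branches) (forest g)).sum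
      = ((cutPairs g).map fun y => pairing (forest u) y.2 * pairing (forest f) (forest y.1)).sum
  | [], u, g => by
    rw [sum_attachments_nil, forest_nil, sum_cutPairs_pairing_zero g (pairing (forest u))]
    rfl
  | .node a :: f, u, g => by
    have ha (u b : List PTree) := sum_attachments_pairing a u b
    have hf := sum_attachments_pairing f
    rw [((attachments_perm (positions_node_cons (node a) f) u _).map _).sum_eq,
      sum_attachments_cons]
    simp only [forest_cons, branches_node, pairing_cons_forest, ← List.sum_map_mul_left]
    rw [sum_cutPairs_picks g fun b r q => pairing (forest u) q *
      (pairing (forest a) (forest b.branches) * pairing (forest f) (forest r))]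
    simp only [sum_map_comm _ (picks g)]
    refine congrArg List.sum (List.map_congr_left fun z _ => ?_)
    simp only [List.sum_map_mul_left, List.sum_map_mul_right, hf, ha]
    simp only [branches_node, pairing_add, ← List.sum_map_mul_right]
    simp only [sum_map_comm _ (splits u)]
    refine congrArg List.sum (List.map_congr_left fun x _ => ?_)
    simp only [← List.sum_map_mul_left]
    refine congrArg List.sum (List.map_congr_left fun y _ => congrArg List.sum
      (List.map_congr_left fun w _ => ?_))
    ring

end PTree

open PTree in
/-- Lemma 1 of the paper. For a forest `u` and rooted trees
`t, t'`: `n(u,t;t')·|Sym(t')| = m(u,t;t')·|Sym(B₊(u))|·|Sym(t)|`, where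
`n(u,t;t')` is the coefficient of `t'` in the Grossman–Larson product
`B₊(u) ∘ t` and `m(u,t;t')` is the number of admissible cuts `c` of `t'` with
`P^c(t') = u` and `R^c(t') = t`. -/
theorem gl_coefficient_cut_count (u : Multiset RTree) (t t' : RTree) :
    (glMul ℚ (RTree.node u) t) t' * (RTree.sym t' : ℚ)
      = (((PTree.cutsOf t'.out).filter (fun c =>
            Cut.admissible c && decide (PcutR t' c = u) && decide (RcutR t' c = t))).length : ℚ)
          * (RTree.sym (RTree.node u) : ℚ) * (RTree.sym t : ℚ) := by
  obtain ⟨f, hf⟩ : ∃ f, t.out = node f := ⟨_, (node_branches _).symm⟩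
  obtain ⟨g, hg⟩ : ∃ g, t'.out = node g := ⟨_, (node_branches _).symm⟩
  obtain ⟨v, hv⟩ : ∃ v, (RTree.node u).out = node v := ⟨_, (node_branches _).symm⟩
  have hf' : toR (node f) = t := by rw [← hf, toR_out]
  have hg' : toR (node g) = t' := by rw [← hg, toR_out]
  have hv' : toR (node v) = RTree.node u := by rw [← hv, toR_out]
  have hu : forest v = u := by
    rw [toR_node_eq_iff.1 hv']
    simp [forest, Function.comp_def, toR_out]
  have hP (d : PTree) : pairing (forest d.branches) (forest g)
      = (Finsupp.single (toR d) (1 : ℚ)) t' * (t'.sym : ℚ) := by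
    rw [← branches_node g, pairing_branches, hg', Finsupp.single_apply, ite_mul, one_mul, zero_mul]
    split_ifs with h
    · rw [h]
    · rfl
  have hL : (glMul ℚ (RTree.node u) t) t' * (t'.sym : ℚ)
      = ((attachments (positions (node f)) v (node f)).map fun d =>
        pairing (forest d.branches) (forest g)).sum := by
    rw [glMul, hv, hf, glMulP, ← sum_sections, ← Finsupp.applyAddHom_apply, map_list_sum,
      List.map_map, ← List.sum_map_mul_right]
    simp only [hP]
    rfl
  rw [hL, sum_attachments_pairing, hg, cutsOf, List.filter_map, List.length_map,
    ← hv', ← hf', sym_toR_node, sym_toR_node, hf', hu, sum_cutPairs, mul_assoc,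
    ← nsmul_eq_mul, ← List.sum_replicate, ← List.map_const, sum_map_filter]
  refine congrArg List.sum (List.map_congr_left fun cs _ => ?_)
  have hp : PcutR t' (.node cs) = forest (cutPiecesList g cs).2 := by
    rw [PcutR, hg, Pcut, cutPieces]; rfl
  have hr : RcutR t' (.node cs) = t ↔ forest f = forest (cutPiecesList g cs).1 := by
    rw [RcutR, hg, Rcut, cutPieces, ← hf', toR_node_eq_iff, eq_comm]
  simp only [Function.comp_apply, Cut.admissible, hp, hr, pairing, eq_comm (b := u)]
  cases Cut.admissibleList cs <;> by_cases h₁ : u = forest (cutPiecesList g cs).2 <;>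
    by_cases h₂ : forest f = forest (cutPiecesList g cs).1 <;> simp [h₁, h₂]
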